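/- arXiv:2001.11352 — 2 statements merged into one kernel-verified Lean document; each statement's English description precedes it below -/
import Mathlib

section
/- Let C be an abelian category and 𝒲 a class of objects of C closed under isomorphisms, finite direct sums, and kernels of epimorphisms (i.e., for every short exact sequence 0→A→B→C→0 with B, C ∈ 𝒲 one has A ∈ 𝒲). Let 0→X→X⁰→X¹→0 be a short exact sequence in C, let (Wᵢ⁰)_{i≥0} be the terms of a proper 𝒲-resolution of X⁰ and (Wᵢ¹)_{i≥0} the terms of a proper 𝒲-resolution of X¹. Then there exists an object W ∈ 𝒲 such that: (1) X admits a proper 𝒲-resolution whose 0-th term is W and whose i-th term is W_{i+1}¹ ⊕ Wᵢ⁰ for all i ≥ 1, and there is a short exact sequence 0→W→W₁¹⊕W₀⁰→W₀¹→0; (2) if the two given proper 𝒲-resolutions are Hom(−,𝒲)-exact and the short exact sequence 0→X→X⁰→X¹→0 is Hom(−,𝒲)-exact, then the proper 𝒲-resolution of X in (1) can be chosen Hom(−,𝒲)-exact. -/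
open CategoryTheory Category Limits

universe v u

variable {C : Type u} [Category.{v} C] [Abelian C]

def SES {A B X : C} (f : A ⟶ B) (g : B ⟶ X) : Prop :=
  ∃ w : f ≫ g = 0, (CategoryTheory.ShortComplex.mk f g w).ShortExact

def CovExact (𝒲 : Set C) {A B X : C} (f : A ⟶ B) (g : B ⟶ X) : Prop :=
  ∀ W ∈ 𝒲,
    (Function.Injective fun u : W ⟶ A => u ≫ f) ∧
    (∀ v : W ⟶ B, v ≫ g = 0 → ∃ u : W ⟶ A, u ≫ f = v) ∧
    (Function.Surjective fun v : W ⟶ B => v ≫ g)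

def ContraExact (𝒲 : Set C) {A B X : C} (f : A ⟶ B) (g : B ⟶ X) : Prop :=
  ∀ W ∈ 𝒲,
    (Function.Injective fun u : X ⟶ W => g ≫ u) ∧
    (∀ v : B ⟶ W, f ≫ v = 0 → ∃ u : X ⟶ W, g ≫ u = v) ∧
    (Function.Surjective fun v : B ⟶ W => f ≫ v)

/-- A proper `𝒲`-resolution of `A` with terms `W i`: short exact sequences
`0 ⟶ K (i+1) ⟶ W i ⟶ K i ⟶ 0` with `K 0 = A`, each `W i ∈ 𝒲`, each `Hom(𝒲,-)`-exact. -/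
structure ProperResolution (𝒲 : Set C) (A : C) (W : ℕ → C) where
  K : ℕ → C
  hK : K 0 = A
  g : ∀ i, K (i + 1) ⟶ W i
  f : ∀ i, W i ⟶ K i
  mem : ∀ i, W i ∈ 𝒲
  ses : ∀ i, SES (g i) (f i)
  proper : ∀ i, CovExact 𝒲 (g i) (f i)

/-- The proper resolution is in addition `Hom(-,𝒲)`-exact. -/
def ProperResolution.IsContraExact {𝒲 : Set C} {A : C} {W : ℕ → C}
    (R : ProperResolution 𝒲 A W) : Prop :=
  ∀ i, ContraExact 𝒲 (R.g i) (R.f i)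

/-- A coproper `𝒲`-coresolution of `A` with terms `W i`: short exact sequences
`0 ⟶ K i ⟶ W i ⟶ K (i+1) ⟶ 0` with `K 0 = A`, each `W i ∈ 𝒲`, each `Hom(-,𝒲)`-exact. -/
structure CoproperCoresolution (𝒲 : Set C) (A : C) (W : ℕ → C) where
  K : ℕ → C
  hK : K 0 = A
  g : ∀ i, K i ⟶ W i
  f : ∀ i, W i ⟶ K (i + 1)
  mem : ∀ i, W i ∈ 𝒲
  ses : ∀ i, SES (g i) (f i)
  coproper : ∀ i, ContraExact 𝒲 (g i) (f i)

/-- The coproper coresolution is in addition `Hom(𝒲,-)`-exact. -/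
def CoproperCoresolution.IsCovExact {𝒲 : Set C} {A : C} {W : ℕ → C}
    (R : CoproperCoresolution 𝒲 A W) : Prop :=
  ∀ i, CovExact 𝒲 (R.g i) (R.f i)

/-- Membership in the Gorenstein category `G(𝒲)`: `X` admits both a proper `𝒲`-resolution
which is `Hom(-,𝒲)`-exact and a coproper `𝒲`-coresolution which is `Hom(𝒲,-)`-exact
(i.e. a complete `𝒲`-resolution). -/
def MemGW (𝒲 : Set C) (X : C) : Prop :=
  (∃ (W : ℕ → C) (R : ProperResolution 𝒲 X W), R.IsContraExact) ∧
  (∃ (W : ℕ → C) (R : CoproperCoresolution 𝒲 X W), R.IsCovExact)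


/-- Every morphism from an object of `𝒲` to the target of `g` factors through `g`. -/
def LiftsAlong (𝒲 : Set C) {B X : C} (g : B ⟶ X) : Prop :=
  ∀ V ∈ 𝒲, ∀ v : V ⟶ X, ∃ u : V ⟶ B, u ≫ g = v

/-- Every morphism from the source of `f` to an object of `𝒲` extends along `f`. -/
def ExtendsAlong (𝒲 : Set C) {A B : C} (f : A ⟶ B) : Prop :=
  ∀ V ∈ 𝒲, ∀ v : A ⟶ V, ∃ u : B ⟶ V, f ≫ u = v

section SES

variable {A B X : C} {f : A ⟶ B} {g : B ⟶ X}

lemma SES.zero (h : SES f g) : f ≫ g = 0 := h.choose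

lemma SES.mono (h : SES f g) : Mono f := h.choose_spec.mono_f

lemma SES.epi (h : SES f g) : Epi g := h.choose_spec.epi_g

lemma SES.exists_lift (h : SES f g) {T : C} (t : T ⟶ B) (ht : t ≫ g = 0) :
    ∃ u : T ⟶ A, u ≫ f = t := by
  obtain ⟨w, hS⟩ := h
  have := hS.mono_f
  exact ⟨hS.exact.lift t ht, hS.exact.lift_f t ht⟩

lemma SES.exists_desc (h : SES f g) {T : C} (t : B ⟶ T) (ht : f ≫ t = 0) :
    ∃ u : X ⟶ T, g ≫ u = t := by
  obtain ⟨w, hS⟩ := h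
  have := hS.epi_g
  exact ⟨hS.exact.desc t ht, hS.exact.g_desc t ht⟩

lemma SES.of_exists_lift [Mono f] [Epi g] (w : f ≫ g = 0)
    (h : ∀ {T : C} (t : T ⟶ B), t ≫ g = 0 → ∃ u : T ⟶ A, u ≫ f = t) : SES f g := by
  refine ⟨w, { exact := ?_, mono_f := ‹_›, epi_g := ‹_› }⟩
  rw [ShortComplex.exact_iff_exact_up_to_refinements]
  intro T t ht
  obtain ⟨u, hu⟩ := h t ht
  exact ⟨T, 𝟙 T, inferInstance, u, by simpa using hu.symm⟩

lemma SES.kernel_ι [Epi g] : SES (kernel.ι g) g :=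
  .of_exists_lift (kernel.condition g) fun t ht => ⟨kernel.lift g t ht, kernel.lift_ι g t ht⟩

lemma SES.covExact {𝒲 : Set C} (h : SES f g) (hg : LiftsAlong 𝒲 g) : CovExact 𝒲 f g := by
  have := h.mono
  exact fun V hV => ⟨fun _ _ e => (cancel_mono f).1 e, fun v => h.exists_lift v, hg V hV⟩

lemma SES.contraExact {𝒲 : Set C} (h : SES f g) (hf : ExtendsAlong 𝒲 f) :
    ContraExact 𝒲 f g := by
  have := h.epi
  exact fun V hV => ⟨fun _ _ e => (cancel_epi g).1 e, fun v => h.exists_desc v, hf V hV⟩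

lemma CovExact.liftsAlong {𝒲 : Set C} (h : CovExact 𝒲 f g) : LiftsAlong 𝒲 g :=
  fun V hV => (h V hV).2.2

lemma ContraExact.extendsAlong {𝒲 : Set C} (h : ContraExact 𝒲 f g) : ExtendsAlong 𝒲 f :=
  fun V hV => (h V hV).2.2

end SES

/-- One step of the horseshoe lemma relative to `𝒲`. -/
lemma horseshoe_step {𝒲 : Set C} {A M B A' B' P Q : C} {a : A ⟶ M} {b : M ⟶ B}
    {k : A' ⟶ P} {p : P ⟶ A} {l : B' ⟶ Q} {q : Q ⟶ B}
    (hab : SES a b) (hkp : SES k p) (hlq : SES l q) (hQ : Q ∈ 𝒲)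
    (hb : LiftsAlong 𝒲 b) (hp : LiftsAlong 𝒲 p) (hq : LiftsAlong 𝒲 q) :
    ∃ (M' : C) (a' : A' ⟶ M') (b' : M' ⟶ B') (g : M' ⟶ P ⊞ Q) (f : P ⊞ Q ⟶ M),
      SES a' b' ∧ LiftsAlong 𝒲 b' ∧ SES g f ∧ LiftsAlong 𝒲 f ∧
      (ExtendsAlong 𝒲 k → ExtendsAlong 𝒲 l → ExtendsAlong 𝒲 a' ∧ ExtendsAlong 𝒲 g) := by
  obtain ⟨s, hs⟩ := hb Q hQ q
  have := hab.mono
  have := hkp.mono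
  have := hlq.mono
  have := hkp.epi
  have := hlq.epi
  let f : P ⊞ Q ⟶ M := biprod.desc (p ≫ a) s
  have hfb : f ≫ b = biprod.snd ≫ q := by
    ext <;> simp [f, hs, hab.zero]
  have : Epi f := by
    refine Preadditive.epi_of_cancel_zero _ fun {T} h hh => ?_
    have h1 : a ≫ h = 0 := by
      rw [← cancel_epi p]
      simpa [f] using congr(biprod.inl ≫ $hh)
    obtain ⟨h', rfl⟩ := hab.exists_desc h h1
    have h2 : h' = 0 := by
      rw [← cancel_epi q, ← hs]
      simpa [f] using congr(biprod.inr ≫ $hh)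
    simp [h2]
  have hgf : SES (kernel.ι f) f := .kernel_ι
  obtain ⟨a', ha'⟩ := hgf.exists_lift (k ≫ biprod.inl) (by simp [f, reassoc_of% hkp.zero])
  obtain ⟨b', hb'⟩ := hlq.exists_lift (kernel.ι f ≫ biprod.snd) (by
    rw [assoc, ← hfb, kernel.condition_assoc, zero_comp])
  have : Mono a' := by
    have : Mono (a' ≫ kernel.ι f) := by rw [ha']; infer_instance
    exact mono_of_mono a' (kernel.ι f)
  have lift_b' {T : C} (y : T ⟶ B') (r : T ⟶ P) (hr : r ≫ p ≫ a = y ≫ l ≫ s) :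
      ∃ z : T ⟶ kernel f, z ≫ b' = y := by
    obtain ⟨z, hz⟩ := hgf.exists_lift (y ≫ l ≫ biprod.inr - r ≫ biprod.inl) (by simp [f, hr])
    refine ⟨z, ?_⟩
    rw [← cancel_mono l, assoc, hb', reassoc_of% hz]
    simp
  have lift_a {T : C} (y : T ⟶ B') : ∃ t : T ⟶ A, t ≫ a = y ≫ l ≫ s :=
    hab.exists_lift _ (by simp [hs, hlq.zero])
  have : Epi b' := by
    rw [epi_iff_surjective_up_to_refinements]
    intro T y
    obtain ⟨t, ht⟩ := lift_a y
    obtain ⟨T', π, hπ, r, hr⟩ := surjective_up_to_refinements_of_epi p t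
    obtain ⟨z, hz⟩ := lift_b' (π ≫ y) r (by rw [← reassoc_of% hr, ht, assoc])
    exact ⟨T', π, hπ, z, hz.symm⟩
  have hab' : SES a' b' := by
    refine .of_exists_lift ?_ fun {T} t ht => ?_
    · rw [← cancel_mono l, assoc, hb', reassoc_of% ha']
      simp
    · have h1 : (t ≫ kernel.ι f) ≫ biprod.snd = 0 := by
        rw [assoc, ← hb', reassoc_of% ht, zero_comp]
      have h2 : t ≫ kernel.ι f = (t ≫ kernel.ι f ≫ biprod.fst) ≫ biprod.inl := by
        ext
        · simp
        · simpa using h1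
      obtain ⟨u, hu⟩ := hkp.exists_lift (t ≫ kernel.ι f ≫ biprod.fst) (by
        rw [← cancel_mono a, zero_comp]
        have h3 : (t ≫ kernel.ι f) ≫ f = 0 := by simp
        rw [h2] at h3
        simpa [f] using h3)
      refine ⟨u, ?_⟩
      rw [← cancel_mono (kernel.ι f), h2, assoc, ha', reassoc_of% hu, assoc, assoc]
  refine ⟨kernel f, a', b', kernel.ι f, f, hab', ?_, hgf, ?_, ?_⟩
  · intro V hV y
    obtain ⟨t, ht⟩ := lift_a y
    obtain ⟨r, hr⟩ := hp V hV t
    exact lift_b' y r (by rw [reassoc_of% hr, ht])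
  · intro V hV v
    obtain ⟨c, hc⟩ := hq V hV (v ≫ b)
    obtain ⟨t, ht⟩ := hab.exists_lift (v - c ≫ s) (by simp [hs, hc])
    obtain ⟨r, hr⟩ := hp V hV t
    exact ⟨biprod.lift r c, by simp [f, reassoc_of% hr, ht]⟩
  · intro hk hl
    refine ⟨fun V hV v => ?_, fun V hV v => ?_⟩
    · obtain ⟨u, hu⟩ := hk V hV v
      exact ⟨kernel.ι f ≫ biprod.desc u 0, by simp [reassoc_of% ha', hu]⟩
    · obtain ⟨u, hu⟩ := hk V hV (a' ≫ v)
      obtain ⟨d, hd⟩ := hab'.exists_desc (v - kernel.ι f ≫ biprod.fst ≫ u)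
        (by simp [reassoc_of% ha', hu])
      obtain ⟨e, he⟩ := hl V hV d
      refine ⟨biprod.fst ≫ u + biprod.snd ≫ e, ?_⟩
      rw [Preadditive.comp_add, ← reassoc_of% hb', he, hd]
      abel

/-- A short exact sequence `0 ⟶ A ⟶ E ⟶ B ⟶ 0` along whose epimorphism maps from `𝒲` lift. -/
structure ProperExtension (𝒲 : Set C) (A B : C) where
  E : C
  a : A ⟶ E
  b : E ⟶ B
  ses : SES a b
  lifts : LiftsAlong 𝒲 b

/-- The horseshoe lemma for proper `𝒲`-resolutions. -/
lemma exists_horseshoe {𝒲 : Set C} (hsum : ∀ {U V : C}, U ∈ 𝒲 → V ∈ 𝒲 → (U ⊞ V) ∈ 𝒲)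
    {A B : C} {P Q : ℕ → C} (RA : ProperResolution 𝒲 A P) (RB : ProperResolution 𝒲 B Q)
    {M : C} {a : A ⟶ M} {b : M ⟶ B} (hab : SES a b) (hb : LiftsAlong 𝒲 b) :
    ∃ R : ProperResolution 𝒲 M (fun i => P i ⊞ Q i),
      RA.IsContraExact → RB.IsContraExact → R.IsContraExact := by
  obtain ⟨KA, rfl, gA, fA, memA, sesA, properA⟩ := RA
  obtain ⟨KB, rfl, gB, fB, memB, sesB, properB⟩ := RB
  have step (n : ℕ) (S : ProperExtension 𝒲 (KA n) (KB n)) :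
      ∃ (S' : ProperExtension 𝒲 (KA (n + 1)) (KB (n + 1)))
        (g : S'.E ⟶ P n ⊞ Q n) (f : P n ⊞ Q n ⟶ S.E), SES g f ∧ LiftsAlong 𝒲 f ∧
        (ExtendsAlong 𝒲 (gA n) → ExtendsAlong 𝒲 (gB n) → ExtendsAlong 𝒲 g) := by
    obtain ⟨M', a', b', g, f, h1, h2, h3, h4, h5⟩ := horseshoe_step S.ses (sesA n) (sesB n)
      (memB n) S.lifts (properA n).liftsAlong (properB n).liftsAlong
    exact ⟨⟨M', a', b', h1, h2⟩, g, f, h3, h4, fun hk hl => (h5 hk hl).2⟩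
  choose next g f hgf hf hext using step
  let S (n : ℕ) : ProperExtension 𝒲 (KA n) (KB n) := Nat.rec ⟨M, a, b, hab, hb⟩ next n
  refine ⟨{ K := fun n => (S n).E
            hK := rfl
            g := fun n => g n (S n)
            f := fun n => f n (S n)
            mem := fun n => hsum (memA n) (memB n)
            ses := fun n => hgf n (S n)
            proper := fun n => (hgf n (S n)).covExact (hf n (S n)) }, fun hA hB n => ?_⟩
  exact (hgf n (S n)).contraExact
    (hext n (S n) (hA n).extendsAlong (hB n).extendsAlong)

/-- The proper `𝒲`-resolution of the first syzygy obtained by deleting the `0`-th term. -/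
def ProperResolution.tail {𝒲 : Set C} {A : C} {W : ℕ → C} (R : ProperResolution 𝒲 A W) :
    ProperResolution 𝒲 (R.K 1) (fun i => W (i + 1)) where
  K n := R.K (n + 1)
  hK := rfl
  g n := R.g (n + 1)
  f n := R.f (n + 1)
  mem n := R.mem (n + 1)
  ses n := R.ses (n + 1)
  proper n := R.proper (n + 1)

section IsPullback

variable {P Y B Z : C} {p : P ⟶ Y} {q : P ⟶ B} {y : Y ⟶ Z} {g : B ⟶ Z}

/-- The pullback of a short exact sequence is short exact. -/
lemma SES.of_isPullback {A : C} {f : A ⟶ B} (h : SES f g) (sq : IsPullback p q y g) :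
    ∃ k : A ⟶ P, SES k p ∧ k ≫ q = f := by
  have := h.epi
  have := h.mono
  have w : (0 : A ⟶ Y) ≫ y = f ≫ g := by rw [zero_comp, h.zero]
  have hq : sq.lift 0 f w ≫ q = f := sq.lift_snd _ _ _
  have hp : sq.lift 0 f w ≫ p = 0 := sq.lift_fst _ _ _
  have : Mono (sq.lift 0 f w) := by
    have : Mono (sq.lift 0 f w ≫ q) := by rwa [hq]
    exact mono_of_mono _ q
  have : Epi p := by
    have : Epi (pullback.fst y g) := inferInstance
    rw [← sq.isoPullback_hom_fst]
    infer_instance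
  refine ⟨sq.lift 0 f w, .of_exists_lift hp fun {T} t ht => ?_, hq⟩
  obtain ⟨u, hu⟩ := h.exists_lift (t ≫ q) (by rw [assoc, ← sq.w, reassoc_of% ht, zero_comp])
  exact ⟨u, sq.hom_ext (by simp [hp, ht]) (by simp [hq, hu])⟩

lemma LiftsAlong.of_isPullback {𝒲 : Set C} (h : LiftsAlong 𝒲 g) (sq : IsPullback p q y g) :
    LiftsAlong 𝒲 p := by
  intro V hV v
  obtain ⟨u, hu⟩ := h V hV (v ≫ y)
  exact ⟨sq.lift v u hu.symm, sq.lift_fst _ _ _⟩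

/-- The preimage under `g` of the kernel of an epimorphism `r` is the kernel of `g ≫ r`. -/
lemma SES.comp_of_isPullback {T : C} {r : Z ⟶ T} [Epi g] (h : SES y r)
    (sq : IsPullback p q y g) : SES q (g ≫ r) := by
  have := h.mono
  have := h.epi
  have : Mono q := by
    refine Preadditive.mono_of_cancel_zero _ fun {V} t ht => sq.hom_ext ?_ (by simpa using ht)
    rw [← cancel_mono y, assoc, sq.w, reassoc_of% ht]
    simp
  have : Epi (g ≫ r) := epi_comp _ _
  refine .of_exists_lift (by rw [← assoc, ← sq.w, assoc, h.zero, comp_zero]) fun t ht => ?_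
  obtain ⟨u, hu⟩ := h.exists_lift (t ≫ g) (by simpa using ht)
  exact ⟨sq.lift u t hu, sq.lift_snd _ _ _⟩

end IsPullback

/-- Constructing a proper `𝒲`-resolution of the first term of a short
exact sequence `0→X→X⁰→X¹→0` from proper `𝒲`-resolutions of the other two terms,
when `𝒲` is closed under isomorphisms, finite direct sums and kernels of epimorphisms. -/
theorem stmt_8 (𝒲 : Set C)
    (hiso : ∀ {U V : C}, (U ≅ V) → U ∈ 𝒲 → V ∈ 𝒲)
    (hsum : ∀ {U V : C}, U ∈ 𝒲 → V ∈ 𝒲 → (U ⊞ V) ∈ 𝒲)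
    (hker : ∀ {A B Z : C} (f : A ⟶ B) (g : B ⟶ Z), SES f g → B ∈ 𝒲 → Z ∈ 𝒲 → A ∈ 𝒲)
    {X X0 X1 : C} (x : X ⟶ X0) (y : X0 ⟶ X1) (hses : SES x y)
    (W0 W1 : ℕ → C)
    (R0 : ProperResolution 𝒲 X0 W0) (R1 : ProperResolution 𝒲 X1 W1) :
    ∃ W : C, W ∈ 𝒲 ∧
      -- the short exact sequence 0 → W → W₁¹ ⊕ W₀⁰ → W₀¹ → 0
      (∃ (u : W ⟶ W1 1 ⊞ W0 0) (v : W1 1 ⊞ W0 0 ⟶ W1 0), SES u v) ∧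
      -- (1) a proper 𝒲-resolution of X with 0-th term W and i-th term W¹_{i+1} ⊕ W⁰_i (i ≥ 1)
      Nonempty (ProperResolution 𝒲 X
        (fun i => match i with | 0 => W | n + 1 => W1 (n + 2) ⊞ W0 (n + 1))) ∧
      -- (2) if everything in sight is Hom(-,𝒲)-exact, the resolution can be chosen
      -- Hom(-,𝒲)-exact as well
      (R0.IsContraExact → R1.IsContraExact → ContraExact 𝒲 x y →
        ∃ R : ProperResolution 𝒲 X
            (fun i => match i with | 0 => W | n + 1 => W1 (n + 2) ⊞ W0 (n + 1)),
          R.IsContraExact) := by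
  obtain ⟨K1, rfl, g1, f1, mem1, ses1, proper1⟩ := R1
  let R1 : ProperResolution 𝒲 (K1 0) W1 := ⟨K1, rfl, g1, f1, mem1, ses1, proper1⟩
  obtain ⟨M, p, q, sq⟩ : ∃ (M : C) (p : M ⟶ X0) (q : M ⟶ W1 0), IsPullback p q y (f1 0) :=
    ⟨_, _, _, .of_hasPullback y (f1 0)⟩
  obtain ⟨k, hk, -⟩ := (ses1 0).of_isPullback sq
  obtain ⟨m, hm, -⟩ := hses.of_isPullback sq.flip
  obtain ⟨⟨L, hL, g, f, mem, ses, proper⟩, hR⟩ :=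
    exists_horseshoe hsum R1.tail R0 hk ((proper1 0).liftsAlong.of_isPullback sq)
  subst hL
  obtain ⟨W, π, ι, sq'⟩ : ∃ (W : C) (π : W ⟶ X) (ι : W ⟶ W1 1 ⊞ W0 0),
      IsPullback π ι m (f 0) := ⟨_, _, _, .of_hasPullback m (f 0)⟩
  obtain ⟨g', hg', hg'ι⟩ := (ses 0).of_isPullback sq'
  have := (ses 0).epi
  have hι : SES ι (f 0 ≫ q) := hm.comp_of_isPullback sq'
  have hW : W ∈ 𝒲 := hker _ _ hι (mem 0) (mem1 0)
  let R : ProperResolution 𝒲 X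
      (fun i => match i with | 0 => W | n + 1 => W1 (n + 2) ⊞ W0 (n + 1)) :=
    { K := fun | 0 => X | n + 1 => L (n + 1)
      hK := rfl
      g := fun | 0 => g' | n + 1 => g (n + 1)
      f := fun | 0 => π | n + 1 => f (n + 1)
      mem := fun | 0 => hW | n + 1 => mem (n + 1)
      ses := fun | 0 => hg' | n + 1 => ses (n + 1)
      proper := fun
        | 0 => hg'.covExact ((proper 0).liftsAlong.of_isPullback sq')
        | n + 1 => proper (n + 1) }
  refine ⟨W, hW, ⟨ι, _, hι⟩, ⟨R⟩, fun h0 h1 _ => ⟨R, ?_⟩⟩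
  have hL := hR (fun n => h1 (n + 1)) h0
  rintro (_ | n)
  · refine hg'.contraExact fun V hV v => ?_
    obtain ⟨u, hu⟩ := (hL 0).extendsAlong V hV v
    exact ⟨ι ≫ u, by rw [← assoc, hg'ι]; exact hu⟩
  · exact hL (n + 1)
end

section
/- Let C be an abelian category and 𝒲 a class of objects of C closed under isomorphisms and finite direct sums. Let 0→Y→Y⁰→Y¹→0 be a Hom(−,𝒲)-exact short exact sequence in C, let (Wᵢ⁰)_{i≥0} be the terms of a coproper 𝒲-coresolution of Y⁰ and (Wᵢ¹)_{i≥0} the terms of a coproper 𝒲-coresolution of Y¹. Then: (1) Y admits a coproper 𝒲-coresolution whose 0-th term is W₀⁰ and whose i-th term is Wᵢ⁰ ⊕ W_{i−1}¹ for all i ≥ 1; (2) if the two given coproper 𝒲-coresolutions are Hom(𝒲,−)-exact and the short exact sequence 0→Y→Y⁰→Y¹→0 is Hom(𝒲,−)-exact, then this coproper 𝒲-coresolution of Y can be chosen Hom(𝒲,−)-exact. -/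
open CategoryTheory Category Limits

universe v u

variable {C : Type u} [Category.{v} C] [Abelian C]

namespace SES

variable {A B X : C} {f : A ⟶ B} {g : B ⟶ X}

theorem comp_eq_zero (h : SES f g) : f ≫ g = 0 := h.1

theorem mono_s11 (h : SES f g) : Mono f := h.2.mono_f

theorem epi_s11 (h : SES f g) : Epi g := h.2.epi_g

theorem exists_lift_s11 (h : SES f g) {T : C} (k : T ⟶ B) (hk : k ≫ g = 0) :
    ∃ u : T ⟶ A, u ≫ f = k := by
  obtain ⟨w, hw⟩ := h
  have := hw.mono_f
  exact ⟨hw.exact.lift k hk, hw.exact.lift_f k hk⟩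

theorem exists_desc_s11 (h : SES f g) {T : C} (k : B ⟶ T) (hk : f ≫ k = 0) :
    ∃ u : X ⟶ T, g ≫ u = k := by
  obtain ⟨w, hw⟩ := h
  have := hw.epi_g
  exact ⟨hw.exact.desc k hk, hw.exact.g_desc k hk⟩

theorem of_exists_desc [Mono f] [Epi g] (w : f ≫ g = 0)
    (h : ∀ {T : C} (k : B ⟶ T), f ≫ k = 0 → ∃ u : X ⟶ T, g ≫ u = k) : SES f g := by
  choose d hd using @h
  refine ⟨w, ?_⟩
  have hc : IsColimit (CokernelCofork.ofπ g w) :=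
    CokernelCofork.IsColimit.ofπ _ _ (fun k hk => d k hk) (fun k hk => hd k hk)
      (fun k hk m hm => by rw [← cancel_epi g, hm, hd])
  exact
    { exact := ShortComplex.exact_of_g_is_cokernel _ hc
      mono_f := inferInstanceAs (Mono f)
      epi_g := inferInstanceAs (Epi g) }

theorem cokernel_π (f : A ⟶ B) [Mono f] : SES f (cokernel.π f) :=
  of_exists_desc (cokernel.condition f) fun k hk => ⟨cokernel.desc f k hk, cokernel.π_desc f k hk⟩

theorem contraExact_s11 (h : SES f g) {𝒲 : Set C}
    (hs : ∀ V ∈ 𝒲, ∀ u : A ⟶ V, ∃ v : B ⟶ V, f ≫ v = u) : ContraExact 𝒲 f g := fun V hV =>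
  have := h.epi_s11
  ⟨fun _ _ huv => (cancel_epi g).1 huv, fun v hv => h.exists_desc_s11 v hv, fun u => hs V hV u⟩

theorem covExact_s11 (h : SES f g) {𝒲 : Set C}
    (hs : ∀ V ∈ 𝒲, ∀ u : V ⟶ X, ∃ v : V ⟶ B, v ≫ g = u) : CovExact 𝒲 f g := fun V hV =>
  have := h.mono_s11
  ⟨fun _ _ huv => (cancel_mono f).1 huv, fun v hv => h.exists_lift_s11 v hv, fun u => hs V hV u⟩

end SES

/-- If `0 ⟶ Y ⟶ Y0 ⟶ Y1 ⟶ 0` and `0 ⟶ Y0 ⟶ W ⟶ A ⟶ 0` are short exact, then the cokernel `Z` of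
`Y ⟶ W` is an extension of `A` by `Y1`, and `Hom`-exactness is inherited. -/
theorem exists_cokernel_comp_extension (𝒲 : Set C) {Y Y0 Y1 W A : C}
    {x : Y ⟶ Y0} {y : Y0 ⟶ Y1} {g : Y0 ⟶ W} {f : W ⟶ A}
    (h : SES x y) (h' : SES g f) (hc : ContraExact 𝒲 x y) (hc' : ContraExact 𝒲 g f) :
    ∃ (Z : C) (p : W ⟶ Z) (b : Y1 ⟶ Z) (a : Z ⟶ A),
      SES (x ≫ g) p ∧ ContraExact 𝒲 (x ≫ g) p ∧ SES b a ∧ ContraExact 𝒲 b a ∧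
      (CovExact 𝒲 x y → CovExact 𝒲 g f → CovExact 𝒲 (x ≫ g) p) := by
  have := h.mono_s11
  have := h.epi_s11
  have := h'.mono_s11
  have := h'.epi_s11
  have hp := SES.cokernel_π (x ≫ g)
  set p := cokernel.π (x ≫ g)
  have := hp.epi_s11
  obtain ⟨b, hb⟩ := h.exists_desc_s11 (g ≫ p) (by rw [← assoc, hp.comp_eq_zero])
  obtain ⟨a, ha⟩ := hp.exists_desc_s11 f (by rw [assoc, h'.comp_eq_zero, comp_zero])
  have hbm : Mono b := by
    refine Preadditive.mono_of_cancel_zero _ fun {T} t ht => ?_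
    obtain ⟨T', q, _, w, hw⟩ := surjective_up_to_refinements_of_epi y t
    obtain ⟨z, hz⟩ := hp.exists_lift_s11 (w ≫ g) (by rw [assoc, ← hb, ← reassoc_of% hw, ht, comp_zero])
    have hzw : z ≫ x = w := by rw [← cancel_mono g, assoc, hz]
    rw [← cancel_epi q, hw, ← hzw, assoc, h.comp_eq_zero, comp_zero, comp_zero]
  have hae : Epi a := by
    have : Epi (p ≫ a) := by rwa [ha]
    exact epi_of_epi p a
  have hba : SES b a := by
    refine SES.of_exists_desc ?_ fun {T} k hk => ?_
    · rw [← cancel_epi y, reassoc_of% hb, ha, h'.comp_eq_zero, comp_zero]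
    · obtain ⟨u, hu⟩ := h'.exists_desc_s11 (p ≫ k) (by rw [← reassoc_of% hb, hk, comp_zero])
      exact ⟨u, by rw [← cancel_epi p, reassoc_of% ha, hu]⟩
  refine ⟨_, p, b, a, hp, hp.contraExact_s11 fun V hV u => ?_, hba, hba.contraExact_s11 fun V hV u => ?_,
    fun hv hv' => hp.covExact_s11 fun V hV u => ?_⟩
  · obtain ⟨v, rfl⟩ := (hc V hV).2.2 u
    obtain ⟨w, rfl⟩ := (hc' V hV).2.2 v
    exact ⟨w, assoc _ _ _⟩
  · obtain ⟨w, hw : g ≫ w = y ≫ u⟩ := (hc' V hV).2.2 (y ≫ u)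
    obtain ⟨v, hv⟩ := hp.exists_desc_s11 w
      (by rw [assoc, hw, ← assoc, h.comp_eq_zero, zero_comp])
    exact ⟨v, by rw [← cancel_epi y, reassoc_of% hb, hv, hw]⟩
  · obtain ⟨w, hw : w ≫ f = u ≫ a⟩ := (hv' V hV).2.2 (u ≫ a)
    obtain ⟨t, ht⟩ := hba.exists_lift_s11 (u - w ≫ p)
      (by rw [Preadditive.sub_comp, assoc, ha, hw, sub_self])
    obtain ⟨s, rfl⟩ := (hv V hV).2.2 t
    refine ⟨s ≫ g + w, ?_⟩
    simp only [assoc, hb] at ht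
    rw [Preadditive.add_comp, assoc, ht, sub_add_cancel]

/-- The relative horseshoe lemma: an extension `Z` of `A` by `B` embeds into `WA ⊞ WB`, with
cokernel an extension of `A'` by `B'`, and `Hom`-exactness is inherited. -/
theorem exists_horseshoe_s11 (𝒲 : Set C) {A B Z WA WB A' B' : C} (hWB : WB ∈ 𝒲)
    {b : B ⟶ Z} {a : Z ⟶ A} {gA : A ⟶ WA} {fA : WA ⟶ A'} {gB : B ⟶ WB} {fB : WB ⟶ B'}
    (h : SES b a) (hA : SES gA fA) (hB : SES gB fB)
    (hc : ContraExact 𝒲 b a) (hcA : ContraExact 𝒲 gA fA) (hcB : ContraExact 𝒲 gB fB) :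
    ∃ (Z' : C) (g : Z ⟶ WA ⊞ WB) (p : WA ⊞ WB ⟶ Z') (b' : B' ⟶ Z') (a' : Z' ⟶ A'),
      SES g p ∧ ContraExact 𝒲 g p ∧ SES b' a' ∧ ContraExact 𝒲 b' a' ∧
      (CovExact 𝒲 gA fA → CovExact 𝒲 gB fB → CovExact 𝒲 g p) := by
  have := h.mono_s11
  have := h.epi_s11
  have := hA.mono_s11
  have := hA.epi_s11
  have := hB.mono_s11
  have := hB.epi_s11
  obtain ⟨e, he : b ≫ e = gB⟩ := (hc WB hWB).2.2 gB
  obtain ⟨g, hg⟩ : ∃ g, g = biprod.lift (a ≫ gA) e := ⟨_, rfl⟩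
  have hg1 : g ≫ biprod.fst = a ≫ gA := by rw [hg, biprod.lift_fst]
  have hg2 : g ≫ biprod.snd = e := by rw [hg, biprod.lift_snd]
  have hbg : b ≫ g = gB ≫ biprod.inr := by
    apply biprod.hom_ext
    · rw [assoc, assoc, hg1, reassoc_of% h.comp_eq_zero, zero_comp, biprod.inr_fst, comp_zero]
    · rw [assoc, assoc, hg2, he, biprod.inr_snd, comp_id]
  have lift_of_fst_eq_zero {T : C} (t : T ⟶ Z) (ht : t ≫ g ≫ biprod.fst = 0) :
      ∃ s : T ⟶ B, s ≫ b = t := by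
    refine h.exists_lift_s11 t ?_
    rw [← cancel_mono gA, assoc, ← hg1, ht, zero_comp]
  have hgm : Mono g := by
    refine Preadditive.mono_of_cancel_zero _ fun {T} t ht => ?_
    obtain ⟨s, rfl⟩ := lift_of_fst_eq_zero t (by rw [reassoc_of% ht, zero_comp])
    have hs : s ≫ gB = 0 := by rw [← he, ← hg2, ← assoc, ← assoc, ht, zero_comp]
    rw [zero_of_comp_mono gB hs, zero_comp]
  have hp := SES.cokernel_π g
  set p := cokernel.π g
  have := hp.epi_s11
  obtain ⟨b', hb'⟩ := hB.exists_desc_s11 (biprod.inr ≫ p)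
    (by rw [← assoc, ← hbg, assoc, hp.comp_eq_zero, comp_zero])
  obtain ⟨a', ha'⟩ := hp.exists_desc_s11 (biprod.fst ≫ fA)
    (by rw [reassoc_of% hg1, hA.comp_eq_zero, comp_zero])
  have hb'm : Mono b' := by
    refine Preadditive.mono_of_cancel_zero _ fun {T} t ht => ?_
    obtain ⟨T', q, _, w, hw⟩ := surjective_up_to_refinements_of_epi fB t
    obtain ⟨z, hz⟩ := hp.exists_lift_s11 (w ≫ biprod.inr)
      (by rw [assoc, ← hb', ← reassoc_of% hw, ht, comp_zero])
    obtain ⟨s, rfl⟩ := lift_of_fst_eq_zero z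
      (by rw [reassoc_of% hz, biprod.inr_fst, comp_zero])
    have hs : s ≫ gB = w := by
      rw [← cancel_mono (biprod.inr : WB ⟶ WA ⊞ WB), assoc, ← hbg, ← assoc, hz]
    rw [← cancel_epi q, hw, ← hs, assoc, hB.comp_eq_zero, comp_zero, comp_zero]
  have ha'e : Epi a' := by
    have : Epi (p ≫ a') := by rw [ha']; infer_instance
    exact epi_of_epi p a'
  have hba : SES b' a' := by
    refine SES.of_exists_desc ?_ fun {T} k hk => ?_
    · rw [← cancel_epi fB, reassoc_of% hb', ha', biprod.inr_fst_assoc, zero_comp, comp_zero]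
    · have hk' : biprod.inr ≫ p ≫ k = 0 := by rw [← reassoc_of% hb', hk, comp_zero]
      have hpk : p ≫ k = biprod.fst ≫ biprod.inl ≫ p ≫ k := by
        apply biprod.hom_ext' <;> simp [hk']
      obtain ⟨u, hu⟩ := hA.exists_desc_s11 (biprod.inl ≫ p ≫ k) (by
        rw [← cancel_epi a, ← reassoc_of% hg1, ← hpk, ← assoc, hp.comp_eq_zero, zero_comp,
          comp_zero])
      exact ⟨u, by rw [← cancel_epi p, reassoc_of% ha', hu, ← hpk]⟩
  have extend {V : C} (hV : V ∈ 𝒲) (u : Z ⟶ V) (v : WB ⟶ V) (huv : b ≫ u = gB ≫ v) :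
      ∃ w : WA ⊞ WB ⟶ V, g ≫ w = u ∧ biprod.inr ≫ w = v := by
    obtain ⟨r, hr⟩ := h.exists_desc_s11 (u - g ≫ biprod.snd ≫ v)
      (by rw [Preadditive.comp_sub, huv, reassoc_of% hg2, reassoc_of% he, sub_self])
    obtain ⟨s, rfl⟩ := (hcA V hV).2.2 r
    refine ⟨biprod.fst ≫ s + biprod.snd ≫ v, ?_, by simp⟩
    rw [Preadditive.comp_add, reassoc_of% hg1, hr, sub_add_cancel]
  refine ⟨_, g, p, b', a', hp, hp.contraExact_s11 fun V hV u => ?_, hba,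
    hba.contraExact_s11 fun V hV u => ?_,
    fun hvA hvB => hp.covExact_s11 fun V hV u => ?_⟩
  · obtain ⟨v, hv⟩ := (hcB V hV).2.2 (b ≫ u)
    obtain ⟨w, hw, -⟩ := extend hV u v hv.symm
    exact ⟨w, hw⟩
  · obtain ⟨w, hw, hw'⟩ := extend hV 0 (fB ≫ u)
      (by rw [reassoc_of% hB.comp_eq_zero, zero_comp, comp_zero])
    obtain ⟨v, hv⟩ := hp.exists_desc_s11 w hw
    exact ⟨v, by rw [← cancel_epi fB, reassoc_of% hb', hv, hw']⟩
  · obtain ⟨w, hw : w ≫ fA = u ≫ a'⟩ := (hvA V hV).2.2 (u ≫ a')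
    obtain ⟨t, ht⟩ := hba.exists_lift_s11 (u - w ≫ biprod.inl ≫ p)
      (by rw [Preadditive.sub_comp, assoc, assoc, ha', biprod.inl_fst_assoc, hw, sub_self])
    obtain ⟨s, rfl⟩ := (hvB V hV).2.2 t
    refine ⟨s ≫ biprod.inr + w ≫ biprod.inl, ?_⟩
    simp only [assoc, hb'] at ht
    rw [Preadditive.add_comp, assoc, assoc, ht, sub_add_cancel]

/-- A coproper coresolution can be built one short exact sequence at a time, carrying along an
invariant `P` of the cosyzygies. -/
theorem CoproperCoresolution.exists_of_step (𝒲 : Set C) (W : ℕ → C) (mem : ∀ n, W n ∈ 𝒲)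
    (P : ℕ → C → Prop) (hcov : Prop)
    (step : ∀ n X, P n X → ∃ (X' : C) (g : X ⟶ W n) (f : W n ⟶ X'),
      SES g f ∧ ContraExact 𝒲 g f ∧ (hcov → CovExact 𝒲 g f) ∧ P (n + 1) X')
    {A : C} (hA : P 0 A) :
    ∃ R : CoproperCoresolution 𝒲 A W, hcov → R.IsCovExact := by
  choose next g f ses contra cov hP using step
  let K : ∀ n, {X : C // P n X} := fun n =>
    Nat.rec ⟨A, hA⟩ (fun n X => ⟨next n X.1 X.2, hP n X.1 X.2⟩) n
  exact ⟨{
    K := fun n => (K n).1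
    hK := rfl
    g := fun n => g n _ (K n).2
    f := fun n => f n _ (K n).2
    mem := mem
    ses := fun n => ses n _ (K n).2
    coproper := fun n => contra n _ (K n).2 }, fun h n => cov n _ (K n).2 h⟩

/-- Constructing a coproper `𝒲`-coresolution of the first term of a
`Hom(-,𝒲)`-exact short exact sequence `0→Y→Y⁰→Y¹→0` from coproper `𝒲`-coresolutions of
the last two terms, when `𝒲` is closed under isomorphisms and finite direct sums. -/
theorem stmt_11 (𝒲 : Set C)
    (hiso : ∀ {U V : C}, (U ≅ V) → U ∈ 𝒲 → V ∈ 𝒲)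
    (hsum : ∀ {U V : C}, U ∈ 𝒲 → V ∈ 𝒲 → (U ⊞ V) ∈ 𝒲)
    {Y Y0 Y1 : C} (x : Y ⟶ Y0) (y : Y0 ⟶ Y1)
    (hses : SES x y) (hcon : ContraExact 𝒲 x y)
    (W0 W1 : ℕ → C)
    (R0 : CoproperCoresolution 𝒲 Y0 W0) (R1 : CoproperCoresolution 𝒲 Y1 W1) :
    -- (1) a coproper 𝒲-coresolution of Y with 0-th term W₀⁰ and i-th term Wᵢ⁰ ⊕ W_{i-1}¹ (i ≥ 1)
    Nonempty (CoproperCoresolution 𝒲 Y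
      (fun i => match i with | 0 => W0 0 | n + 1 => W0 (n + 1) ⊞ W1 n)) ∧
    -- (2) if everything in sight is Hom(𝒲,-)-exact, it can be chosen Hom(𝒲,-)-exact as well
    (R0.IsCovExact → R1.IsCovExact → CovExact 𝒲 x y →
      ∃ R : CoproperCoresolution 𝒲 Y
          (fun i => match i with | 0 => W0 0 | n + 1 => W0 (n + 1) ⊞ W1 n),
        R.IsCovExact) := by
  suffices H : ∃ R : CoproperCoresolution 𝒲 Y
      (fun i => match i with | 0 => W0 0 | n + 1 => W0 (n + 1) ⊞ W1 n),
      (R0.IsCovExact ∧ R1.IsCovExact ∧ CovExact 𝒲 x y) → R.IsCovExact by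
    obtain ⟨R, hR⟩ := H
    exact ⟨⟨R⟩, fun h0 h1 h => ⟨R, hR ⟨h0, h1, h⟩⟩⟩
  obtain ⟨K0, rfl, g0, f0, mem0, ses0, con0⟩ := R0
  obtain ⟨K1, rfl, g1, f1, mem1, ses1, con1⟩ := R1
  let hcov : Prop := (∀ i, CovExact 𝒲 (g0 i) (f0 i)) ∧ (∀ i, CovExact 𝒲 (g1 i) (f1 i)) ∧
    CovExact 𝒲 x y
  let IsExt (B A Z : C) : Prop := ∃ (b : B ⟶ Z) (a : Z ⟶ A), SES b a ∧ ContraExact 𝒲 b a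
  refine CoproperCoresolution.exists_of_step 𝒲 _ ?_
    (fun i X => match i with
      | 0 => X = Y
      | n + 1 => IsExt (K1 n) (K0 (n + 1)) X) hcov ?_ rfl
  · rintro (_ | n)
    · exact mem0 0
    · exact hsum (mem0 (n + 1)) (mem1 n)
  · rintro (_ | n) X hX
    · obtain rfl : X = Y := hX
      obtain ⟨Z, p, b, a, hp, hpc, hba, hbac, hv⟩ :=
        exists_cokernel_comp_extension 𝒲 hses (ses0 0) hcon (con0 0)
      exact ⟨Z, x ≫ g0 0, p, hp, hpc, fun h => hv h.2.2 (h.1 0), b, a, hba, hbac⟩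
    · obtain ⟨b, a, h, hc⟩ := hX
      obtain ⟨Z, g, p, b', a', hp, hpc, hba, hbac, hv⟩ :=
        exists_horseshoe_s11 𝒲 (mem1 n) h (ses0 (n + 1)) (ses1 n) hc (con0 (n + 1)) (con1 n)
      exact ⟨Z, g, p, hp, hpc, fun h => hv (h.1 (n + 1)) (h.2.1 n), b', a', hba, hbac⟩
end
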